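/- Reflection of computation: for all EPTS terms M, N, (1) if ⟦M⟧ reduces to ⟦N⟧ in zero or more ↪_{β𝓡_EPTS} steps in Dedukti, then M reduces to N in zero or more EPTS steps; (2) if ⟦M⟧ ≡_{β𝓡_EPTS} ⟦N⟧ in Dedukti, then M ≡ N in the EPTS. -/

import Mathlib

namespace DKPaper

inductive Tm (C : Type) : Type
  | var : Nat → Tm C
  | const : C → List (Tm C) → Tm C
  | type : Tm C
  | kind : Tm C
  | app : Tm C → Tm C → Tm C
  | lam : Tm C → Tm C → Tm C
  | pi : Tm C → Tm C → Tm C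

namespace Tm
variable {C : Type}

def liftRen (ρ : Nat → Nat) : Nat → Nat
  | 0 => 0
  | n + 1 => ρ n + 1

def ren (ρ : Nat → Nat) : Tm C → Tm C
  | var n => var (ρ n)
  | const c Ms => const c (Ms.attach.map fun x => ren ρ x.1)
  | type => type
  | kind => kind
  | app M N => app (ren ρ M) (ren ρ N)
  | lam A M => lam (ren ρ A) (ren (liftRen ρ) M)
  | pi A B => pi (ren ρ A) (ren (liftRen ρ) B)
termination_by t => sizeOf t
decreasing_by
  all_goals simp_wf
  all_goals try omega
  all_goals (have h := List.sizeOf_lt_of_mem x.2; omega)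

def liftSub (σ : Nat → Tm C) : Nat → Tm C
  | 0 => var 0
  | n + 1 => ren Nat.succ (σ n)

def sub (σ : Nat → Tm C) : Tm C → Tm C
  | var n => σ n
  | const c Ms => const c (Ms.attach.map fun x => sub σ x.1)
  | type => type
  | kind => kind
  | app M N => app (sub σ M) (sub σ N)
  | lam A M => lam (sub σ A) (sub (liftSub σ) M)
  | pi A B => pi (sub σ A) (sub (liftSub σ) B)
termination_by t => sizeOf t
decreasing_by
  all_goals simp_wf
  all_goals try omega
  all_goals (have h := List.sizeOf_lt_of_mem x.2; omega)

/-- Substitution of `N` for the variable of de Bruijn index `k` (the usual `M{N/x}`). -/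
def substAt (k : Nat) (N : Tm C) : Tm C → Tm C :=
  sub fun n => if n < k then var n else if n = k then ren (· + k) N else var (n - 1)

end Tm

/-! ## Signatures, rewrite rules, rewriting -/

/-- An entry `c[Δ] : A` of a signature: head constant, telescope (in declaration
order, each entry a type under the previous ones), and the type. -/
abbrev Sig (C : Type) := Set (C × List (Tm C) × Tm C)

/-- A rewrite rule `c[l⃗] ↪ r`: head constant, list of left-hand side argument
patterns (free de Bruijn variables are the pattern variables), right-hand side. -/
abbrev Rules (C : Type) := Set (C × List (Tm C) × Tm C)

variable {C : Type}

/-- Closure of a root relation under all term-forming contexts. -/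
inductive Cong (r : Tm C → Tm C → Prop) : Tm C → Tm C → Prop
  | base {M N} : r M N → Cong r M N
  | appL {M M' N} : Cong r M M' → Cong r (.app M N) (.app M' N)
  | appR {M N N'} : Cong r N N' → Cong r (.app M N) (.app M N')
  | lamA {A A' M} : Cong r A A' → Cong r (.lam A M) (.lam A' M)
  | lamM {A M M'} : Cong r M M' → Cong r (.lam A M) (.lam A M')
  | piA {A A' B} : Cong r A A' → Cong r (.pi A B) (.pi A' B)
  | piB {A B B'} : Cong r B B' → Cong r (.pi A B) (.pi A B')
  | constArg {c l₁ M M' l₂} : Cong r M M' →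
      Cong r (.const c (l₁ ++ M :: l₂)) (.const c (l₁ ++ M' :: l₂))

/-- Root β-reduction. -/
def BetaRoot : Tm C → Tm C → Prop := fun M N =>
  ∃ A P Q, M = .app (.lam A P) Q ∧ N = Tm.substAt 0 Q P

/-- Root reduction by a rule of `R`: a substitution instance of some rule. -/
def RuleRoot (R : Rules C) : Tm C → Tm C → Prop := fun M N =>
  ∃ rl ∈ R, ∃ σ : Nat → Tm C,
    M = Tm.sub σ (.const rl.1 rl.2.1) ∧ N = Tm.sub σ rl.2.2

/-- One-step β-reduction `↪_β`. -/
def Beta : Tm C → Tm C → Prop := Cong BetaRoot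

/-- One-step reduction by the rules of `R` only (no β). -/
def RStep (R : Rules C) : Tm C → Tm C → Prop := Cong (RuleRoot R)

/-- One-step reduction `↪_{β𝓡}`. -/
def Step (R : Rules C) : Tm C → Tm C → Prop :=
  Cong (fun M N => BetaRoot M N ∨ RuleRoot R M N)

/-- The conversion `≡_{β𝓡}` generated by `↪_{β𝓡}`. -/
def Conv (R : Rules C) : Tm C → Tm C → Prop := Relation.EqvGen (Step R)

/-- Confluence of an abstract reduction relation. -/
def Confluent {α : Type _} (r : α → α → Prop) : Prop :=
  ∀ a b c, Relation.ReflTransGen r a b → Relation.ReflTransGen r a c →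
    ∃ d, Relation.ReflTransGen r b d ∧ Relation.ReflTransGen r c d

/-- `M` is in β-normal form. -/
def BetaNormal (M : Tm C) : Prop := ∀ N, ¬ Beta M N

/-- Strong normalization of a relation at a point: no infinite `r`-sequence starts at `a`. -/
def SN {α : Type _} (r : α → α → Prop) (a : α) : Prop := Acc (fun x y => r y x) a


/-! ## Dedukti typing -/

/-- `IsDKSort s` means `s` is `TYPE` or `KIND`. -/
def IsDKSort (s : Tm C) : Prop := s = Tm.type ∨ s = Tm.kind

/-- `A{M⃗}`: simultaneous instantiation of the telescope variables by the arguments. -/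
def instArgs (Ms : List (Tm C)) (A : Tm C) : Tm C :=
  Tm.sub (fun n => Ms.reverse.getD n (Tm.var (n - Ms.length))) A

/-- Instantiate the first variable of the (remaining) telescope `Δ` with `M`. -/
def instTele (M : Tm C) (Δ : List (Tm C)) : List (Tm C) :=
  Δ.mapIdx fun i B => Tm.substAt i M B

mutual
/-- Well-formed contexts `Σ;Γ well-formed` (de Bruijn: last declaration first). -/
inductive Wf (S : Sig C) (R : Rules C) : List (Tm C) → Prop
  | empty : Wf S R []
  | decl {Γ A} : Typed S R Γ A Tm.type → Wf S R (A :: Γ)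

/-- The Dedukti typing judgment `Σ;Γ ⊢ M : A`. -/
inductive Typed (S : Sig C) (R : Rules C) : List (Tm C) → Tm C → Tm C → Prop
  | sort {Γ} : Wf S R Γ → Typed S R Γ Tm.type Tm.kind
  | var {Γ n A} : Wf S R Γ → Γ[n]? = some A →
      Typed S R Γ (Tm.var n) (Tm.ren (· + (n + 1)) A)
  | cons {Γ c Δ A s Ms} : (c, Δ, A) ∈ S → Typed S R Δ.reverse A s → IsDKSort s →
      TypedArgs S R Γ Ms Δ → Typed S R Γ (Tm.const c Ms) (instArgs Ms A)
  | conv {Γ M A B s} : Typed S R Γ M A → Typed S R Γ B s → IsDKSort s →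
      Conv R A B → Typed S R Γ M B
  | prod {Γ A B s} : Typed S R Γ A Tm.type → Typed S R (A :: Γ) B s → IsDKSort s →
      Typed S R Γ (Tm.pi A B) s
  | abs {Γ A B s M} : Typed S R Γ A Tm.type → Typed S R (A :: Γ) B s → IsDKSort s →
      Typed S R (A :: Γ) M B → Typed S R Γ (Tm.lam A M) (Tm.pi A B)
  | app {Γ M N A B} : Typed S R Γ M (Tm.pi A B) → Typed S R Γ N A →
      Typed S R Γ (Tm.app M N) (Tm.substAt 0 N B)

/-- `Σ;Γ ⊢ M⃗ : Δ`: the arguments fit the telescope. -/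
inductive TypedArgs (S : Sig C) (R : Rules C) : List (Tm C) → List (Tm C) → List (Tm C) → Prop
  | nil {Γ} : TypedArgs S R Γ [] []
  | cons {Γ M Ms A Δ} : Typed S R Γ M A → TypedArgs S R Γ Ms (instTele M Δ) →
      TypedArgs S R Γ (M :: Ms) (A :: Δ)
end

/-! ## Type-level and object-level constants, syntactic classes -/

/-- Types of the form `Πx⃗:B⃗.TYPE`. -/
inductive IsKindShape : Tm C → Prop
  | type : IsKindShape Tm.type
  | pi {A K} : IsKindShape K → IsKindShape (Tm.pi A K)

/-- `c` is a type-level constant of the signature `S`. -/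
def TypeLevel (S : Sig C) (c : C) : Prop := ∃ Δ A, (c, Δ, A) ∈ S ∧ IsKindShape A

/-- `c` is an object-level constant of the signature `S`: it is declared, and not type-level. -/
def ObjLevel (S : Sig C) (c : C) : Prop := (∃ Δ A, (c, Δ, A) ∈ S) ∧ ¬ TypeLevel S c

mutual
/-- Kinds: `K ::= TYPE | Πx:T.K`. -/
inductive IsKind (S : Sig C) : Tm C → Prop
  | type : IsKind S Tm.type
  | pi {T K} : IsTypeFam S T → IsKind S K → IsKind S (Tm.pi T K)

/-- Type families: `T ::= α[O⃗] | T O | λx:T.T | Πx:T.T` with `α` type-level. -/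
inductive IsTypeFam (S : Sig C) : Tm C → Prop
  | const {c Os} : TypeLevel S c → (∀ O ∈ Os, IsObj S O) → IsTypeFam S (Tm.const c Os)
  | app {T O} : IsTypeFam S T → IsObj S O → IsTypeFam S (Tm.app T O)
  | lam {T₁ T₂} : IsTypeFam S T₁ → IsTypeFam S T₂ → IsTypeFam S (Tm.lam T₁ T₂)
  | pi {T₁ T₂} : IsTypeFam S T₁ → IsTypeFam S T₂ → IsTypeFam S (Tm.pi T₁ T₂)

/-- Objects: `O ::= x | a[O⃗] | O O | λx:T.O` with `a` object-level. -/
inductive IsObj (S : Sig C) : Tm C → Prop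
  | var {n} : IsObj S (Tm.var n)
  | const {c Os} : ObjLevel S c → (∀ O ∈ Os, IsObj S O) → IsObj S (Tm.const c Os)
  | app {O₁ O₂} : IsObj S O₁ → IsObj S O₂ → IsObj S (Tm.app O₁ O₂)
  | lam {T O} : IsTypeFam S T → IsObj S O → IsObj S (Tm.lam T O)
end

mutual
/-- Pre-kinds: `L ::= TYPE | Πx:R.L`. -/
inductive PreKind (S : Sig C) : Tm C → Prop
  | type : PreKind S Tm.type
  | pi {R L} : PreTypeFam S R → PreKind S L → PreKind S (Tm.pi R L)

/-- Pre-type families: `R ::= α[M⃗] | R N | λx:A.R | Πx:R.R` with `α` type-level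
and `M⃗`, `N`, `A` arbitrary. -/
inductive PreTypeFam (S : Sig C) : Tm C → Prop
  | const {c Ms} : TypeLevel S c → PreTypeFam S (Tm.const c Ms)
  | app {R N} : PreTypeFam S R → PreTypeFam S (Tm.app R N)
  | lam {A R} : PreTypeFam S R → PreTypeFam S (Tm.lam A R)
  | pi {R₁ R₂} : PreTypeFam S R₁ → PreTypeFam S R₂ → PreTypeFam S (Tm.pi R₁ R₂)
end

/-- A rewrite rule is type-level when its head constant is type-level. -/
def TypeLevelRule (S : Sig C) (rl : C × List (Tm C) × Tm C) : Prop := TypeLevel S rl.1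

/-- The grammar `R ::= α[M⃗] | R N | λx:A.R` used to define arity preservation. -/
inductive APShape (S : Sig C) : Tm C → Prop
  | const {c Ms} : TypeLevel S c → APShape S (Tm.const c Ms)
  | app {R N} : APShape S R → APShape S (Tm.app R N)
  | lam {A R} : APShape S R → APShape S (Tm.lam A R)

/-- `𝓡` is arity preserving (w.r.t. `Σ`). -/
def ArityPreserving (S : Sig C) (R : Rules C) : Prop :=
  ∀ rl ∈ R, TypeLevelRule S rl → APShape S rl.2.2

/-- `𝓡` is well-formed (w.r.t. `Σ`): right-hand sides of type-level rules are in
the grammar `R ::= α[M⃗] | R N | λx:B.R | Πx:R.R`. -/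
def RulesWellFormed (S : Sig C) (R : Rules C) : Prop :=
  ∀ rl ∈ R, TypeLevelRule S rl → PreTypeFam S rl.2.2

/-! ## Simple types and the erasure maps -/

/-- Simple types `σ ::= * | σ → σ`. -/
inductive STy : Type
  | star : STy
  | arr : STy → STy → STy
deriving DecidableEq

open Classical in
/-- The partial type erasure `⌈·⌉` from Dedukti terms to simple types. -/
noncomputable def tyErase (S : Sig C) : Tm C → Option STy
  | Tm.type => some STy.star
  | Tm.const c _ => if TypeLevel S c then some STy.star else none
  | Tm.pi A B => do return STy.arr (← tyErase S A) (← tyErase S B)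
  | Tm.app A _ => tyErase S A
  | Tm.lam _ B => tyErase S B
  | Tm.var _ => none
  | Tm.kind => none

/-- Untyped λ-terms with constants in `K` (the target of the term erasure). -/
inductive LTm (K : Type) : Type
  | var : Nat → LTm K
  | const : K → LTm K
  | app : LTm K → LTm K → LTm K
  | lam : LTm K → LTm K

namespace LTm
variable {K : Type}

def liftRen' (ρ : Nat → Nat) : Nat → Nat
  | 0 => 0
  | n + 1 => ρ n + 1

def ren (ρ : Nat → Nat) : LTm K → LTm K
  | var n => var (ρ n)
  | const k => const k
  | app M N => app (ren ρ M) (ren ρ N)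
  | lam M => lam (ren (liftRen' ρ) M)

/-- Shift free variables `≥ d` up by one. -/
def shiftAbove (d : Nat) : LTm K → LTm K :=
  ren fun n => if n < d then n else n + 1

def liftSub (σ : Nat → LTm K) : Nat → LTm K
  | 0 => var 0
  | n + 1 => ren Nat.succ (σ n)

def sub (σ : Nat → LTm K) : LTm K → LTm K
  | var n => σ n
  | const k => const k
  | app M N => app (sub σ M) (sub σ N)
  | lam M => lam (sub (liftSub σ) M)

/-- Substitution `M{N/x}` for the variable of index `k`. -/
def substAt (k : Nat) (N : LTm K) : LTm K → LTm K :=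
  sub fun n => if n < k then var n else if n = k then ren (· + k) N else var (n - 1)

end LTm

/-- β-reduction for the (simply-typed) λ-calculus. -/
inductive LBeta {K : Type} : LTm K → LTm K → Prop
  | red {M N} : LBeta (LTm.app (LTm.lam M) N) (LTm.substAt 0 N M)
  | appL {M M' N} : LBeta M M' → LBeta (LTm.app M N) (LTm.app M' N)
  | appR {M N N'} : LBeta N N' → LBeta (LTm.app M N) (LTm.app M N')
  | lam {M M'} : LBeta M M' → LBeta (LTm.lam M) (LTm.lam M')

/-- The partial term erasure `|·|` from Dedukti terms into the λ-calculus with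
constants `C ⊕ STy` (`Sum.inr σ` being the constant `π_σ`). -/
noncomputable def erase (S : Sig C) : Tm C → Option (LTm (C ⊕ STy))
  | Tm.var n => some (LTm.var n)
  | Tm.const c Ms => do
      let ts ← Ms.attach.mapM fun x => erase S x.1
      return ts.foldl LTm.app (LTm.const (Sum.inl c))
  | Tm.app M N => do return LTm.app (← erase S M) (← erase S N)
  | Tm.lam A M => do
      return LTm.app (LTm.lam (LTm.lam (LTm.shiftAbove 1 (← erase S M)))) (← erase S A)
  | Tm.pi A B => do
      return LTm.app (LTm.app (LTm.const (Sum.inr (← tyErase S A))) (← erase S A))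
        (LTm.lam (← erase S B))
  | Tm.type => none
  | Tm.kind => none
termination_by t => sizeOf t
decreasing_by
  all_goals simp_wf
  all_goals try omega
  all_goals (have h := List.sizeOf_lt_of_mem x.2; omega)

/-- The type `* → (σ → *) → *` of the constant `π_σ`. -/
def piConstTy (σ : STy) : STy := STy.arr STy.star (STy.arr (STy.arr σ STy.star) STy.star)

/-- `⌈A₁⌉ → ... → ⌈Aₙ⌉ → ⌈A⌉`, as a relation (defined when all erasures are). -/
inductive EraseTele (S : Sig C) : List (Tm C) → Tm C → STy → Prop
  | nil {A σ} : tyErase S A = some σ → EraseTele S [] A σ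
  | cons {B Δ A τ σ} : tyErase S B = some τ → EraseTele S Δ A σ →
      EraseTele S (B :: Δ) A (STy.arr τ σ)

/-- The simply-typed constant context `Γ_π, ⌈Σ'⌉`: it declares `π_σ : * → (σ → *) → *`
for every simple type `σ`, and `c : ⌈A₁⌉ → ... → ⌈Aₙ⌉ → ⌈A⌉` for every
declaration `c[x₁:A₁,...,xₙ:Aₙ] : A` of `Σ'` (erasures being taken w.r.t. `S`). -/
inductive ConstTy (S : Sig C) (S' : Sig C) : C ⊕ STy → STy → Prop
  | piConst (σ : STy) : ConstTy S S' (Sum.inr σ) (piConstTy σ)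
  | const {c Δ A σ} : (c, Δ, A) ∈ S' → EraseTele S Δ A σ → ConstTy S S' (Sum.inl c) σ

/-- Typing in the simply-typed λ-calculus, with constants typed by `cty`. -/
inductive STTyped {K : Type} (cty : K → STy → Prop) : List STy → LTm K → STy → Prop
  | var {Γ n σ} : Γ[n]? = some σ → STTyped cty Γ (LTm.var n) σ
  | const {Γ k σ} : cty k σ → STTyped cty Γ (LTm.const k) σ
  | app {Γ M N σ τ} : STTyped cty Γ M (STy.arr σ τ) → STTyped cty Γ N σ →
      STTyped cty Γ (LTm.app M N) τ
  | lam {Γ M σ τ} : STTyped cty (σ :: Γ) M τ → STTyped cty Γ (LTm.lam M) (STy.arr σ τ)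

/-! ## Explicitly-typed Pure Type Systems (EPTS) -/

/-- EPTS terms (de Bruijn): `x | s | Π_{s₁,s₂}(A,[x]B) | λ_{s₁,s₂}(A,[x]B,[x]M) |
@_{s₁,s₂}(A,[x]B,M,N)`. -/
inductive ETm (S : Type) : Type
  | var : Nat → ETm S
  | sort : S → ETm S
  | pi : S → S → ETm S → ETm S → ETm S
  | lam : S → S → ETm S → ETm S → ETm S → ETm S
  | app : S → S → ETm S → ETm S → ETm S → ETm S → ETm S

namespace ETm
variable {S : Type}

def ren (ρ : Nat → Nat) : ETm S → ETm S
  | var n => var (ρ n)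
  | sort s => sort s
  | pi s₁ s₂ A B => pi s₁ s₂ (ren ρ A) (ren (Tm.liftRen ρ) B)
  | lam s₁ s₂ A B M => lam s₁ s₂ (ren ρ A) (ren (Tm.liftRen ρ) B) (ren (Tm.liftRen ρ) M)
  | app s₁ s₂ A B M N => app s₁ s₂ (ren ρ A) (ren (Tm.liftRen ρ) B) (ren ρ M) (ren ρ N)

def liftSub (σ : Nat → ETm S) : Nat → ETm S
  | 0 => var 0
  | n + 1 => ren Nat.succ (σ n)

def sub (σ : Nat → ETm S) : ETm S → ETm S
  | var n => σ n
  | sort s => sort s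
  | pi s₁ s₂ A B => pi s₁ s₂ (sub σ A) (sub (liftSub σ) B)
  | lam s₁ s₂ A B M => lam s₁ s₂ (sub σ A) (sub (liftSub σ) B) (sub (liftSub σ) M)
  | app s₁ s₂ A B M N => app s₁ s₂ (sub σ A) (sub (liftSub σ) B) (sub σ M) (sub σ N)

/-- Substitution `M{N/x}` for the variable of de Bruijn index `k`. -/
def substAt (k : Nat) (N : ETm S) : ETm S → ETm S :=
  sub fun n => if n < k then var n else if n = k then ren (· + k) N else var (n - 1)

end ETm

variable {S : Type}

/-- Closure of a root relation under all EPTS term-forming contexts. -/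
inductive ECong (r : ETm S → ETm S → Prop) : ETm S → ETm S → Prop
  | base {M N} : r M N → ECong r M N
  | piA {s₁ s₂ A A' B} : ECong r A A' → ECong r (.pi s₁ s₂ A B) (.pi s₁ s₂ A' B)
  | piB {s₁ s₂ A B B'} : ECong r B B' → ECong r (.pi s₁ s₂ A B) (.pi s₁ s₂ A B')
  | lamA {s₁ s₂ A A' B M} : ECong r A A' → ECong r (.lam s₁ s₂ A B M) (.lam s₁ s₂ A' B M)
  | lamB {s₁ s₂ A B B' M} : ECong r B B' → ECong r (.lam s₁ s₂ A B M) (.lam s₁ s₂ A B' M)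
  | lamM {s₁ s₂ A B M M'} : ECong r M M' → ECong r (.lam s₁ s₂ A B M) (.lam s₁ s₂ A B M')
  | appA {s₁ s₂ A A' B M N} : ECong r A A' → ECong r (.app s₁ s₂ A B M N) (.app s₁ s₂ A' B M N)
  | appB {s₁ s₂ A B B' M N} : ECong r B B' → ECong r (.app s₁ s₂ A B M N) (.app s₁ s₂ A B' M N)
  | appM {s₁ s₂ A B M M' N} : ECong r M M' → ECong r (.app s₁ s₂ A B M N) (.app s₁ s₂ A B M' N)
  | appN {s₁ s₂ A B M N N'} : ECong r N N' → ECong r (.app s₁ s₂ A B M N) (.app s₁ s₂ A B M N')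

/-- Root β-reduction of the EPTS (linearized rule, one instance per `(s₁,s₂,s₃) ∈ ℛ`):
`@_{s₁,s₂}(A,[x]B, λ_{s₁,s₂}(A',[x]B',[x]M), N) ↪ M{N/x}`. -/
def EBetaRoot (Rrel : S → S → S → Prop) : ETm S → ETm S → Prop := fun M N =>
  ∃ s₁ s₂ s₃ A B A' B' P Q, Rrel s₁ s₂ s₃ ∧
    M = ETm.app s₁ s₂ A B (ETm.lam s₁ s₂ A' B' P) Q ∧ N = ETm.substAt 0 Q P

/-- One-step EPTS reduction. -/
def EStep (Rrel : S → S → S → Prop) : ETm S → ETm S → Prop := ECong (EBetaRoot Rrel)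

/-- EPTS conversion `≡`. -/
def EConv (Rrel : S → S → S → Prop) : ETm S → ETm S → Prop := Relation.EqvGen (EStep Rrel)

mutual
/-- Well-formed EPTS contexts. -/
inductive EWf (Ar : S → S → Prop) (Rr : S → S → S → Prop) : List (ETm S) → Prop
  | empty : EWf Ar Rr []
  | decl {Γ A s} : ETyped Ar Rr Γ A (ETm.sort s) → EWf Ar Rr (A :: Γ)

/-- The EPTS typing judgment `Γ ⊢ M : A`. -/
inductive ETyped (Ar : S → S → Prop) (Rr : S → S → S → Prop) : List (ETm S) → ETm S → ETm S → Prop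
  | sort {Γ s₁ s₂} : EWf Ar Rr Γ → Ar s₁ s₂ → ETyped Ar Rr Γ (ETm.sort s₁) (ETm.sort s₂)
  | var {Γ n A} : EWf Ar Rr Γ → Γ[n]? = some A →
      ETyped Ar Rr Γ (ETm.var n) (ETm.ren (· + (n + 1)) A)
  | conv {Γ M A B s} : ETyped Ar Rr Γ M A → ETyped Ar Rr Γ B (ETm.sort s) →
      EConv Rr A B → ETyped Ar Rr Γ M B
  | pi {Γ s₁ s₂ s₃ A B} : Rr s₁ s₂ s₃ → ETyped Ar Rr Γ A (ETm.sort s₁) →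
      ETyped Ar Rr (A :: Γ) B (ETm.sort s₂) →
      ETyped Ar Rr Γ (ETm.pi s₁ s₂ A B) (ETm.sort s₃)
  | lam {Γ s₁ s₂ s₃ A B M} : Rr s₁ s₂ s₃ → ETyped Ar Rr Γ A (ETm.sort s₁) →
      ETyped Ar Rr (A :: Γ) B (ETm.sort s₂) → ETyped Ar Rr (A :: Γ) M B →
      ETyped Ar Rr Γ (ETm.lam s₁ s₂ A B M) (ETm.pi s₁ s₂ A B)
  | app {Γ s₁ s₂ s₃ A B M N} : Rr s₁ s₂ s₃ → ETyped Ar Rr Γ A (ETm.sort s₁) →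
      ETyped Ar Rr (A :: Γ) B (ETm.sort s₂) → ETyped Ar Rr Γ N A →
      ETyped Ar Rr Γ M (ETm.pi s₁ s₂ A B) →
      ETyped Ar Rr Γ (ETm.app s₁ s₂ A B M N) (ETm.substAt 0 N B)
end

/-- `𝒜` and `ℛ` are functional relations. -/
def FunctionalSpec (Ar : S → S → Prop) (Rr : S → S → S → Prop) : Prop :=
  (∀ s t t', Ar s t → Ar s t' → t = t') ∧
  (∀ s₁ s₂ t t', Rr s₁ s₂ t → Rr s₁ s₂ t' → t = t')

/-- `s` is a top-sort. -/
def IsTopSort (Ar : S → S → Prop) (s : S) : Prop := ¬ ∃ s', Ar s s'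

/-- `Γ ⊢ A type`: `A` is a sort, or `Γ ⊢ A : s` for some sort `s`. -/
def ETypeJ (Ar : S → S → Prop) (Rr : S → S → S → Prop) (Γ : List (ETm S)) (A : ETm S) : Prop :=
  (∃ s, A = ETm.sort s) ∨ ∃ s, ETyped Ar Rr Γ A (ETm.sort s)

/-! ## (Implicit) Pure Type Systems -/

/-- PTS terms. -/
inductive PTm (S : Type) : Type
  | var : Nat → PTm S
  | sort : S → PTm S
  | pi : PTm S → PTm S → PTm S
  | lam : PTm S → PTm S → PTm S
  | app : PTm S → PTm S → PTm S

namespace PTm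
variable {S : Type}

def ren (ρ : Nat → Nat) : PTm S → PTm S
  | var n => var (ρ n)
  | sort s => sort s
  | pi A B => pi (ren ρ A) (ren (Tm.liftRen ρ) B)
  | lam A M => lam (ren ρ A) (ren (Tm.liftRen ρ) M)
  | app M N => app (ren ρ M) (ren ρ N)

def liftSub (σ : Nat → PTm S) : Nat → PTm S
  | 0 => var 0
  | n + 1 => ren Nat.succ (σ n)

def sub (σ : Nat → PTm S) : PTm S → PTm S
  | var n => σ n
  | sort s => sort s
  | pi A B => pi (sub σ A) (sub (liftSub σ) B)
  | lam A M => lam (sub σ A) (sub (liftSub σ) M)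
  | app M N => app (sub σ M) (sub σ N)

def substAt (k : Nat) (N : PTm S) : PTm S → PTm S :=
  sub fun n => if n < k then var n else if n = k then ren (· + k) N else var (n - 1)

end PTm

/-- One-step β-reduction of PTS terms. -/
inductive PBeta : PTm S → PTm S → Prop
  | red {A M N} : PBeta (PTm.app (PTm.lam A M) N) (PTm.substAt 0 N M)
  | piA {A A' B} : PBeta A A' → PBeta (PTm.pi A B) (PTm.pi A' B)
  | piB {A B B'} : PBeta B B' → PBeta (PTm.pi A B) (PTm.pi A B')
  | lamA {A A' M} : PBeta A A' → PBeta (PTm.lam A M) (PTm.lam A' M)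
  | lamM {A M M'} : PBeta M M' → PBeta (PTm.lam A M) (PTm.lam A M')
  | appL {M M' N} : PBeta M M' → PBeta (PTm.app M N) (PTm.app M' N)
  | appR {M N N'} : PBeta N N' → PBeta (PTm.app M N) (PTm.app M N')

/-- PTS conversion. -/
def PConv : PTm S → PTm S → Prop := Relation.EqvGen PBeta

mutual
/-- Well-formed PTS contexts. -/
inductive PWf (Ar : S → S → Prop) (Rr : S → S → S → Prop) : List (PTm S) → Prop
  | empty : PWf Ar Rr []
  | decl {Γ A s} : PTyped Ar Rr Γ A (PTm.sort s) → PWf Ar Rr (A :: Γ)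

/-- The PTS typing judgment. -/
inductive PTyped (Ar : S → S → Prop) (Rr : S → S → S → Prop) : List (PTm S) → PTm S → PTm S → Prop
  | sort {Γ s₁ s₂} : PWf Ar Rr Γ → Ar s₁ s₂ → PTyped Ar Rr Γ (PTm.sort s₁) (PTm.sort s₂)
  | var {Γ n A} : PWf Ar Rr Γ → Γ[n]? = some A →
      PTyped Ar Rr Γ (PTm.var n) (PTm.ren (· + (n + 1)) A)
  | conv {Γ M A B s} : PTyped Ar Rr Γ M A → PTyped Ar Rr Γ B (PTm.sort s) →
      PConv A B → PTyped Ar Rr Γ M B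
  | pi {Γ s₁ s₂ s₃ A B} : Rr s₁ s₂ s₃ → PTyped Ar Rr Γ A (PTm.sort s₁) →
      PTyped Ar Rr (A :: Γ) B (PTm.sort s₂) →
      PTyped Ar Rr Γ (PTm.pi A B) (PTm.sort s₃)
  | lam {Γ s₁ s₂ s₃ A B M} : Rr s₁ s₂ s₃ → PTyped Ar Rr Γ A (PTm.sort s₁) →
      PTyped Ar Rr (A :: Γ) B (PTm.sort s₂) → PTyped Ar Rr (A :: Γ) M B →
      PTyped Ar Rr Γ (PTm.lam A M) (PTm.pi A B)
  | app {Γ A B M N} : PTyped Ar Rr Γ M (PTm.pi A B) → PTyped Ar Rr Γ N A →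
      PTyped Ar Rr Γ (PTm.app M N) (PTm.substAt 0 N B)
end

/-- `Γ ⊢_PTS A type`. -/
def PTypeJ (Ar : S → S → Prop) (Rr : S → S → S → Prop) (Γ : List (PTm S)) (A : PTm S) : Prop :=
  (∃ s, A = PTm.sort s) ∨ ∃ s, PTyped Ar Rr Γ A (PTm.sort s)

/-- The natural erasure from EPTS terms to PTS terms. -/
def epsErase : ETm S → PTm S
  | ETm.var n => PTm.var n
  | ETm.sort s => PTm.sort s
  | ETm.pi _ _ A B => PTm.pi (epsErase A) (epsErase B)
  | ETm.lam _ _ A _ M => PTm.lam (epsErase A) (epsErase M)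
  | ETm.app _ _ _ _ M N => PTm.app (epsErase M) (epsErase N)

/-! ## The encoding of EPTSs in Dedukti -/

/-- The constants of the theory `(Σ_EPTS, 𝓡_EPTS)`. -/
inductive EConst (S : Type) : Type
  | U : S → EConst S
  | El : S → EConst S
  | u : S → EConst S
  | Prod : S → S → EConst S
  | abs : S → S → EConst S
  | app : S → S → EConst S

/-- `U_s`. -/
def Ucon (s : S) : Tm (EConst S) := Tm.const (EConst.U s) []
/-- `El_s A`. -/
def Elcon (s : S) (A : Tm (EConst S)) : Tm (EConst S) := Tm.const (EConst.El s) [A]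
/-- `u_s`. -/
def ucon (s : S) : Tm (EConst S) := Tm.const (EConst.u s) []
/-- `Prod_{s₁,s₂} A B`. -/
def ProdC (s₁ s₂ : S) (A B : Tm (EConst S)) : Tm (EConst S) :=
  Tm.const (EConst.Prod s₁ s₂) [A, B]
/-- `abs_{s₁,s₂} A B M`. -/
def absC (s₁ s₂ : S) (A B M : Tm (EConst S)) : Tm (EConst S) :=
  Tm.const (EConst.abs s₁ s₂) [A, B, M]
/-- `app_{s₁,s₂} A B M N`. -/
def appC (s₁ s₂ : S) (A B M N : Tm (EConst S)) : Tm (EConst S) :=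
  Tm.const (EConst.app s₁ s₂) [A, B, M, N]

/-- The signature `Σ_EPTS` (telescopes in de Bruijn form). -/
inductive SigEPTSMem (Ar : S → S → Prop) (Rr : S → S → S → Prop) :
    EConst S × List (Tm (EConst S)) × Tm (EConst S) → Prop
  | U (s : S) : SigEPTSMem Ar Rr (EConst.U s, [], Tm.type)
  | El (s : S) : SigEPTSMem Ar Rr (EConst.El s, [Ucon s], Tm.type)
  | u {s₁ s₂} : Ar s₁ s₂ → SigEPTSMem Ar Rr (EConst.u s₁, [], Ucon s₂)
  | Prod {s₁ s₂ s₃} : Rr s₁ s₂ s₃ →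
      SigEPTSMem Ar Rr (EConst.Prod s₁ s₂,
        [Ucon s₁, Tm.pi (Elcon s₁ (Tm.var 0)) (Ucon s₂)],
        Ucon s₃)
  | abs {s₁ s₂ s₃} : Rr s₁ s₂ s₃ →
      SigEPTSMem Ar Rr (EConst.abs s₁ s₂,
        [Ucon s₁, Tm.pi (Elcon s₁ (Tm.var 0)) (Ucon s₂),
         Tm.pi (Elcon s₁ (Tm.var 1)) (Elcon s₂ (Tm.app (Tm.var 1) (Tm.var 0)))],
        Elcon s₃ (ProdC s₁ s₂ (Tm.var 2) (Tm.var 1)))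
  | app {s₁ s₂ s₃} : Rr s₁ s₂ s₃ →
      SigEPTSMem Ar Rr (EConst.app s₁ s₂,
        [Ucon s₁, Tm.pi (Elcon s₁ (Tm.var 0)) (Ucon s₂),
         Elcon s₃ (ProdC s₁ s₂ (Tm.var 1) (Tm.var 0)),
         Elcon s₁ (Tm.var 2)],
        Elcon s₂ (Tm.app (Tm.var 2) (Tm.var 0)))

/-- `Σ_EPTS` as a signature. -/
def sigEPTS (Ar : S → S → Prop) (Rr : S → S → S → Prop) : Sig (EConst S) :=
  fun e => SigEPTSMem Ar Rr e

/-- The rules `El_{s₂} u_{s₁} ↪ U_{s₁}` for `(s₁,s₂) ∈ 𝒜`. -/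
inductive URulesMem (Ar : S → S → Prop) :
    EConst S × List (Tm (EConst S)) × Tm (EConst S) → Prop
  | u_red {s₁ s₂} : Ar s₁ s₂ → URulesMem Ar (EConst.El s₂, [ucon s₁], Ucon s₁)

/-- The rules `app_{s₁,s₂} A B (abs_{s₁,s₂} A' B' M) N ↪ M N` for `(s₁,s₂,s₃) ∈ ℛ`
(pattern variables `A,B,A',B',M,N` are the de Bruijn variables `0,…,5`). -/
inductive BetaRulesMem (Rr : S → S → S → Prop) :
    EConst S × List (Tm (EConst S)) × Tm (EConst S) → Prop
  | beta {s₁ s₂ s₃} : Rr s₁ s₂ s₃ →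
      BetaRulesMem Rr (EConst.app s₁ s₂,
        [Tm.var 0, Tm.var 1, absC s₁ s₂ (Tm.var 2) (Tm.var 3) (Tm.var 4), Tm.var 5],
        Tm.app (Tm.var 4) (Tm.var 5))

/-- The `u_{s₁}`-red rules as a rule set. -/
def uRules (Ar : S → S → Prop) : Rules (EConst S) := fun e => URulesMem Ar e

/-- The `beta_{s₁,s₂}` rules as a rule set. -/
def betaRules (Rr : S → S → S → Prop) : Rules (EConst S) := fun e => BetaRulesMem Rr e

/-- The rewrite system `𝓡_EPTS`. -/
def rulesEPTS (Ar : S → S → Prop) (Rr : S → S → S → Prop) : Rules (EConst S) :=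
  uRules Ar ∪ betaRules Rr

/-- The translation `⟦·⟧` from EPTS terms to Dedukti terms. -/
def trans : ETm S → Tm (EConst S)
  | ETm.var n => Tm.var n
  | ETm.sort s => ucon s
  | ETm.pi s₁ s₂ A B =>
      ProdC s₁ s₂ (trans A) (Tm.lam (Elcon s₁ (trans A)) (trans B))
  | ETm.lam s₁ s₂ A B M =>
      absC s₁ s₂ (trans A) (Tm.lam (Elcon s₁ (trans A)) (trans B))
        (Tm.lam (Elcon s₁ (trans A)) (trans M))
  | ETm.app s₁ s₂ A B M N =>
      appC s₁ s₂ (trans A) (Tm.lam (Elcon s₁ (trans A)) (trans B)) (trans M) (trans N)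

/-- The translation `⟦·⟧` on (well-formed) contexts: `⟦Γ, x:A⟧ = ⟦Γ⟧, x : El_{s_A} ⟦A⟧`
where `Γ ⊢ A : s_A`. -/
inductive TransCtx (Ar : S → S → Prop) (Rr : S → S → S → Prop) :
    List (ETm S) → List (Tm (EConst S)) → Prop
  | nil : TransCtx Ar Rr [] []
  | cons {Γ Δ A sA} : TransCtx Ar Rr Γ Δ → ETyped Ar Rr Γ A (ETm.sort sA) →
      TransCtx Ar Rr (A :: Γ) (Elcon sA (trans A) :: Δ)

/-- Invertible forms. -/
inductive Invertible : Tm (EConst S) → Prop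
  | var {n} : Invertible (Tm.var n)
  | u {s} : Invertible (ucon s)
  | abs {s₁ s₂ A T₁ B T₂ M} : Invertible A → Invertible B → Invertible M →
      Invertible (absC s₁ s₂ A (Tm.lam T₁ B) (Tm.lam T₂ M))
  | beta {T M N} : Invertible M → Invertible N →
      Invertible (Tm.app (Tm.lam T M) N)
  | prod {s₁ s₂ A T₁ B} : Invertible A → Invertible B →
      Invertible (ProdC s₁ s₂ A (Tm.lam T₁ B))
  | app {s₁ s₂ A T₁ B M N} : Invertible A → Invertible B → Invertible M → Invertible N →
      Invertible (appC s₁ s₂ A (Tm.lam T₁ B) M N)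

/-- The inverse translation `|·|`, defined (at least) on invertible forms. -/
def inv : Tm (EConst S) → Option (ETm S)
  | Tm.var n => some (ETm.var n)
  | Tm.const (EConst.u s) [] => some (ETm.sort s)
  | Tm.app (Tm.lam _ M) N => do
      return ETm.substAt 0 (← inv N) (← inv M)
  | Tm.const (EConst.Prod s₁ s₂) [A, Tm.lam _ B] => do
      return ETm.pi s₁ s₂ (← inv A) (← inv B)
  | Tm.const (EConst.abs s₁ s₂) [A, Tm.lam _ B, Tm.lam _ M] => do
      return ETm.lam s₁ s₂ (← inv A) (← inv B) (← inv M)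
  | Tm.const (EConst.app s₁ s₂) [A, Tm.lam _ B, M, N] => do
      return ETm.app s₁ s₂ (← inv A) (← inv B) (← inv M) (← inv N)
  | _ => none
termination_by t => sizeOf t
decreasing_by
  all_goals simp_wf
  all_goals omega

/-- Hidden rewriting steps: a `↪_{β𝓡}` step inside the type annotation of a binder. -/
def HStep (R : Rules (EConst S)) : Tm (EConst S) → Tm (EConst S) → Prop :=
  Cong fun M N => ∃ A A' P, Step R A A' ∧ M = Tm.lam A P ∧ N = Tm.lam A' P

/-- The hidden conversion `≡_H`. -/
def HConv (R : Rules (EConst S)) : Tm (EConst S) → Tm (EConst S) → Prop :=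
  Relation.EqvGen (HStep R)


/-! ## Untyped terms

The annotation-free target of the Dedukti terms: binder annotations are dropped, and every Dedukti
term that is not headed by an application, an abstraction, a variable or a fully applied `u`,
`Prod`, `abs` or `app` is collapsed to `junk`. -/

/-- Untyped terms. -/
inductive UTm (S : Type) : Type
  | var : Nat → UTm S
  | junk : UTm S
  | app : UTm S → UTm S → UTm S
  | lam : UTm S → UTm S
  | u : S → UTm S
  | prod : S → S → UTm S → UTm S → UTm S
  | abs : S → S → UTm S → UTm S → UTm S → UTm S
  | capp : S → S → UTm S → UTm S → UTm S → UTm S → UTm S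

namespace UTm

/-- Renaming of variables. -/
def ren (ρ : Nat → Nat) : UTm S → UTm S
  | var n => var (ρ n)
  | junk => junk
  | app M N => app (ren ρ M) (ren ρ N)
  | lam M => lam (ren (Tm.liftRen ρ) M)
  | u s => u s
  | prod s₁ s₂ A B => prod s₁ s₂ (ren ρ A) (ren ρ B)
  | abs s₁ s₂ A B M => abs s₁ s₂ (ren ρ A) (ren ρ B) (ren ρ M)
  | capp s₁ s₂ A B M N => capp s₁ s₂ (ren ρ A) (ren ρ B) (ren ρ M) (ren ρ N)

/-- Lifting of a substitution under a binder. -/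
def liftSub (σ : Nat → UTm S) : Nat → UTm S
  | 0 => var 0
  | n + 1 => ren Nat.succ (σ n)

/-- Simultaneous substitution. -/
def sub (σ : Nat → UTm S) : UTm S → UTm S
  | var n => σ n
  | junk => junk
  | app M N => app (sub σ M) (sub σ N)
  | lam M => lam (sub (liftSub σ) M)
  | u s => u s
  | prod s₁ s₂ A B => prod s₁ s₂ (sub σ A) (sub σ B)
  | abs s₁ s₂ A B M => abs s₁ s₂ (sub σ A) (sub σ B) (sub σ M)
  | capp s₁ s₂ A B M N => capp s₁ s₂ (sub σ A) (sub σ B) (sub σ M) (sub σ N)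

/-- The substitution of `N` for the variable `0`. -/
def single (N : UTm S) : Nat → UTm S
  | 0 => N
  | n + 1 => var n

/-- Instantiation of the variable `0` of `M` by `N`. -/
def inst (N M : UTm S) : UTm S := sub (single N) M

theorem liftRen_comp (ρ ρ' : Nat → Nat) :
    Tm.liftRen ρ' ∘ Tm.liftRen ρ = Tm.liftRen (ρ' ∘ ρ) := by
  funext n; cases n <;> rfl

theorem ren_ren (ρ ρ' : Nat → Nat) (t : UTm S) : ren ρ' (ren ρ t) = ren (ρ' ∘ ρ) t := by
  induction t generalizing ρ ρ' <;> simp_all [ren, liftRen_comp]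

theorem liftSub_comp_liftRen (ρ : Nat → Nat) (σ : Nat → UTm S) :
    liftSub σ ∘ Tm.liftRen ρ = liftSub (σ ∘ ρ) := by
  funext n; cases n <;> rfl

theorem sub_ren (ρ : Nat → Nat) (σ : Nat → UTm S) (t : UTm S) :
    sub σ (ren ρ t) = sub (σ ∘ ρ) t := by
  induction t generalizing ρ σ <;> simp_all [ren, sub, liftSub_comp_liftRen]

theorem ren_comp_liftSub (ρ : Nat → Nat) (σ : Nat → UTm S) :
    ren (Tm.liftRen ρ) ∘ liftSub σ = liftSub (ren ρ ∘ σ) := by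
  funext n
  cases n with
  | zero => rfl
  | succ n =>
    simp only [Function.comp_apply, liftSub, ren_ren]
    rfl

theorem ren_sub (ρ : Nat → Nat) (σ : Nat → UTm S) (t : UTm S) :
    ren ρ (sub σ t) = sub (ren ρ ∘ σ) t := by
  induction t generalizing ρ σ <;> simp_all [ren, sub, ren_comp_liftSub]

theorem sub_comp_liftSub (σ τ : Nat → UTm S) :
    sub (liftSub τ) ∘ liftSub σ = liftSub (sub τ ∘ σ) := by
  funext n
  cases n with
  | zero => rfl
  | succ n =>
    simp only [Function.comp_apply, liftSub, sub_ren, ren_sub]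
    rfl

theorem sub_sub (σ τ : Nat → UTm S) (t : UTm S) : sub τ (sub σ t) = sub (sub τ ∘ σ) t := by
  induction t generalizing σ τ <;> simp_all [sub, sub_comp_liftSub]

theorem liftSub_var : liftSub (var : Nat → UTm S) = var := by
  funext n; cases n <;> rfl

theorem sub_var (t : UTm S) : sub var t = t := by
  induction t <;> simp_all [sub, liftSub_var]

theorem liftRen_id : Tm.liftRen id = id := by
  funext n; cases n <;> rfl

theorem ren_id (t : UTm S) : ren id t = t := by
  induction t <;> simp_all [ren, liftRen_id]

theorem ren_inst (ρ : Nat → Nat) (N M : UTm S) :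
    ren ρ (inst N M) = inst (ren ρ N) (ren (Tm.liftRen ρ) M) := by
  simp only [inst, ren_sub, sub_ren]
  congr 1
  funext n; cases n <;> rfl

theorem sub_inst (σ : Nat → UTm S) (N M : UTm S) :
    sub σ (inst N M) = inst (sub σ N) (sub (liftSub σ) M) := by
  simp only [inst, sub_sub]
  congr 1
  funext n
  cases n with
  | zero => rfl
  | succ n =>
    simp only [Function.comp_apply, liftSub, sub_ren, single, sub]
    exact (sub_var _).symm

end UTm

/-! ### Parallel reduction of untyped terms -/

/-- Parallel reduction of untyped terms. -/
inductive UPar (Rr : S → S → S → Prop) : UTm S → UTm S → Prop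
  | var {n} : UPar Rr (.var n) (.var n)
  | junk : UPar Rr .junk .junk
  | app {M M' N N'} : UPar Rr M M' → UPar Rr N N' → UPar Rr (.app M N) (.app M' N')
  | lam {M M'} : UPar Rr M M' → UPar Rr (.lam M) (.lam M')
  | u {s} : UPar Rr (.u s) (.u s)
  | prod {s₁ s₂ A A' B B'} : UPar Rr A A' → UPar Rr B B' →
      UPar Rr (.prod s₁ s₂ A B) (.prod s₁ s₂ A' B')
  | abs {s₁ s₂ A A' B B' M M'} : UPar Rr A A' → UPar Rr B B' → UPar Rr M M' →
      UPar Rr (.abs s₁ s₂ A B M) (.abs s₁ s₂ A' B' M')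
  | capp {s₁ s₂ A A' B B' M M' N N'} : UPar Rr A A' → UPar Rr B B' → UPar Rr M M' →
      UPar Rr N N' → UPar Rr (.capp s₁ s₂ A B M N) (.capp s₁ s₂ A' B' M' N')
  | beta {M M' N N'} : UPar Rr M M' → UPar Rr N N' →
      UPar Rr (.app (.lam M) N) (UTm.inst N' M')
  | cbeta {s₁ s₂ s₃ A B A' B' M M' N N'} : Rr s₁ s₂ s₃ → UPar Rr M M' → UPar Rr N N' →
      UPar Rr (.capp s₁ s₂ A B (.abs s₁ s₂ A' B' M) N) (.app M' N')

namespace UPar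
variable {Rr : S → S → S → Prop}

theorem refl (t : UTm S) : UPar Rr t t := by
  induction t <;> constructor <;> assumption

theorem ren (ρ : Nat → Nat) {t t' : UTm S} (h : UPar Rr t t') :
    UPar Rr (UTm.ren ρ t) (UTm.ren ρ t') := by
  induction h generalizing ρ with
  | beta _ _ ihM ihN =>
    rw [UTm.ren_inst]
    exact .beta (ihM _) (ihN _)
  | cbeta hR _ _ ihM ihN => exact .cbeta hR (ihM _) (ihN _)
  | _ => constructor <;> simp_all

theorem liftSub {σ σ' : Nat → UTm S} (h : ∀ n, UPar Rr (σ n) (σ' n)) (n : Nat) :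
    UPar Rr (UTm.liftSub σ n) (UTm.liftSub σ' n) := by
  cases n with
  | zero => exact .var
  | succ n => exact (h n).ren _

theorem sub {σ σ' : Nat → UTm S} (hσ : ∀ n, UPar Rr (σ n) (σ' n)) {t t' : UTm S}
    (h : UPar Rr t t') : UPar Rr (UTm.sub σ t) (UTm.sub σ' t') := by
  induction h generalizing σ σ' with
  | var => exact hσ _
  | lam _ ih => exact .lam (ih (liftSub hσ))
  | beta _ _ ihM ihN =>
    rw [UTm.sub_inst]
    exact .beta (ihM (liftSub hσ)) (ihN hσ)
  | cbeta hR _ _ ihM ihN => exact .cbeta hR (ihM hσ) (ihN hσ)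
  | _ => constructor <;> simp_all

theorem inst {M M' N N' : UTm S} (hM : UPar Rr M M') (hN : UPar Rr N N') :
    UPar Rr (UTm.inst N M) (UTm.inst N' M') := by
  refine hM.sub fun n => ?_
  cases n with
  | zero => exact hN
  | succ n => exact .var

theorem diamond {t a b : UTm S} (ha : UPar Rr t a) (hb : UPar Rr t b) :
    ∃ d, UPar Rr a d ∧ UPar Rr b d := by
  induction ha generalizing b with
  | var => exact ⟨b, hb, refl b⟩
  | junk => exact ⟨b, hb, refl b⟩
  | u => exact ⟨b, hb, refl b⟩
  | lam _ ih =>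
    cases hb with
    | lam h =>
      obtain ⟨d, h₁, h₂⟩ := ih h
      exact ⟨_, .lam h₁, .lam h₂⟩
  | prod _ _ ihA ihB =>
    cases hb with
    | prod hA hB =>
      obtain ⟨_, a₁, a₂⟩ := ihA hA
      obtain ⟨_, b₁, b₂⟩ := ihB hB
      exact ⟨_, .prod a₁ b₁, .prod a₂ b₂⟩
  | abs _ _ _ ihA ihB ihM =>
    cases hb with
    | abs hA hB hM =>
      obtain ⟨_, a₁, a₂⟩ := ihA hA
      obtain ⟨_, b₁, b₂⟩ := ihB hB
      obtain ⟨_, m₁, m₂⟩ := ihM hM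
      exact ⟨_, .abs a₁ b₁ m₁, .abs a₂ b₂ m₂⟩
  | app hM _ ihM ihN =>
    cases hb with
    | app hM' hN' =>
      obtain ⟨_, m₁, m₂⟩ := ihM hM'
      obtain ⟨_, n₁, n₂⟩ := ihN hN'
      exact ⟨_, .app m₁ n₁, .app m₂ n₂⟩
    | beta hP' hN' =>
      obtain ⟨_, n₁, n₂⟩ := ihN hN'
      obtain ⟨_, m₁, m₂⟩ := ihM (.lam hP')
      cases hM
      cases m₁ with
      | lam m₁ =>
        cases m₂ with
        | lam m₂ => exact ⟨_, .beta m₁ n₁, m₂.inst n₂⟩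
  | beta _ _ ihM ihN =>
    cases hb with
    | app hM' hN' =>
      cases hM' with
      | lam hM' =>
        obtain ⟨_, m₁, m₂⟩ := ihM hM'
        obtain ⟨_, n₁, n₂⟩ := ihN hN'
        exact ⟨_, m₁.inst n₁, .beta m₂ n₂⟩
    | beta hM' hN' =>
      obtain ⟨_, m₁, m₂⟩ := ihM hM'
      obtain ⟨_, n₁, n₂⟩ := ihN hN'
      exact ⟨_, m₁.inst n₁, m₂.inst n₂⟩
  | capp _ _ hM _ ihA ihB ihM ihN =>
    cases hb with
    | capp hA' hB' hM' hN' =>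
      obtain ⟨_, a₁, a₂⟩ := ihA hA'
      obtain ⟨_, b₁, b₂⟩ := ihB hB'
      obtain ⟨_, m₁, m₂⟩ := ihM hM'
      obtain ⟨_, n₁, n₂⟩ := ihN hN'
      exact ⟨_, .capp a₁ b₁ m₁ n₁, .capp a₂ b₂ m₂ n₂⟩
    | cbeta hR hP' hN' =>
      obtain ⟨_, n₁, n₂⟩ := ihN hN'
      obtain ⟨_, m₁, m₂⟩ := ihM (.abs (refl _) (refl _) hP')
      cases hM
      cases m₁ with
      | abs _ _ m₁ =>
        cases m₂ with
        | abs _ _ m₂ => exact ⟨_, .cbeta hR m₁ n₁, .app m₂ n₂⟩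
  | cbeta hR _ _ ihM ihN =>
    cases hb with
    | capp _ _ hM' hN' =>
      cases hM' with
      | abs _ _ hM' =>
        obtain ⟨_, m₁, m₂⟩ := ihM hM'
        obtain ⟨_, n₁, n₂⟩ := ihN hN'
        exact ⟨_, .app m₁ n₁, .cbeta hR m₂ n₂⟩
    | cbeta _ hM' hN' =>
      obtain ⟨_, m₁, m₂⟩ := ihM hM'
      obtain ⟨_, n₁, n₂⟩ := ihN hN'
      exact ⟨_, .app m₁ n₁, .app m₂ n₂⟩

theorem join_of_eqvGen {a b : UTm S} (h : Relation.EqvGen (UPar Rr) a b) :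
    Relation.Join (Relation.ReflTransGen (UPar Rr)) a b := by
  have hd : ∀ a b c : UTm S, UPar Rr a b → UPar Rr a c →
      ∃ d, Relation.ReflGen (UPar Rr) b d ∧ Relation.ReflTransGen (UPar Rr) c d := by
    intro a b c hb hc
    obtain ⟨d, h₁, h₂⟩ := diamond hb hc
    exact ⟨d, .single h₁, .single h₂⟩
  have hequiv := Relation.equivalence_join_reflTransGen hd
  induction h with
  | rel a b h => exact ⟨b, .single h, .refl⟩
  | refl a => exact hequiv.refl a
  | symm _ _ _ ih => exact hequiv.symm ih
  | trans _ _ _ _ _ ih₁ ih₂ => exact hequiv.trans ih₁ ih₂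

end UPar

/-! ### Forgetting binder annotations -/

/-- The untyped term with head constant `c` and arguments `l`. -/
def UTm.ofConst : EConst S → List (UTm S) → UTm S
  | .u s, [] => .u s
  | .Prod s₁ s₂, [A, B] => .prod s₁ s₂ A B
  | .abs s₁ s₂, [A, B, M] => .abs s₁ s₂ A B M
  | .app s₁ s₂, [A, B, M, N] => .capp s₁ s₂ A B M N
  | _, _ => .junk

/-- The untyped term underlying a Dedukti term. -/
def forget : Tm (EConst S) → UTm S
  | .var n => .var n
  | .const c Ms => UTm.ofConst c (Ms.attach.map fun x => forget x.1)
  | .type => .junk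
  | .kind => .junk
  | .app M N => .app (forget M) (forget N)
  | .lam _ M => .lam (forget M)
  | .pi _ _ => .junk
termination_by t => sizeOf t
decreasing_by
  all_goals simp_wf
  all_goals try omega
  all_goals (have h := List.sizeOf_lt_of_mem x.2; omega)

theorem forget_const (c : EConst S) (Ms : List (Tm (EConst S))) :
    forget (.const c Ms) = UTm.ofConst c (Ms.map forget) := by
  simp [forget]

theorem Tm.ren_const (ρ : Nat → Nat) (c : C) (Ms : List (Tm C)) :
    Tm.ren ρ (.const c Ms) = .const c (Ms.map (Tm.ren ρ)) := by
  simp [Tm.ren]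

theorem Tm.sub_const (σ : Nat → Tm C) (c : C) (Ms : List (Tm C)) :
    Tm.sub σ (.const c Ms) = .const c (Ms.map (Tm.sub σ)) := by
  simp [Tm.sub]

theorem UTm.ren_ofConst (ρ : Nat → Nat) (c : EConst S) (l : List (UTm S)) :
    UTm.ren ρ (UTm.ofConst c l) = UTm.ofConst c (l.map (UTm.ren ρ)) := by
  rcases c with _ | _ | _ | _ | _ | _ <;>
    rcases l with _ | ⟨_, _ | ⟨_, _ | ⟨_, _ | ⟨_, _ | ⟨_, _⟩⟩⟩⟩⟩ <;> rfl

theorem UTm.sub_ofConst (σ : Nat → UTm S) (c : EConst S) (l : List (UTm S)) :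
    UTm.sub σ (UTm.ofConst c l) = UTm.ofConst c (l.map (UTm.sub σ)) := by
  rcases c with _ | _ | _ | _ | _ | _ <;>
    rcases l with _ | ⟨_, _ | ⟨_, _ | ⟨_, _ | ⟨_, _ | ⟨_, _⟩⟩⟩⟩⟩ <;> rfl

theorem UPar.ofConst {Rr : S → S → S → Prop} (c : EConst S) {l l' : List (UTm S)}
    (h : List.Forall₂ (UPar Rr) l l') : UPar Rr (UTm.ofConst c l) (UTm.ofConst c l') := by
  rcases c with _ | _ | _ | _ | _ | _ <;>
    rcases h with _ | ⟨_, _ | ⟨_, _ | ⟨_, _ | ⟨_, _ | ⟨_, _⟩⟩⟩⟩⟩ <;>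
    first
      | exact UPar.refl _
      | (constructor <;> assumption)

theorem forget_ren (ρ : Nat → Nat) (t : Tm (EConst S)) :
    forget (Tm.ren ρ t) = UTm.ren ρ (forget t) := by
  induction ρ, t using Tm.ren.induct with
  | case2 ρ c Ms ih =>
    rw [Tm.ren_const, forget_const, forget_const, UTm.ren_ofConst]
    simp only [List.map_map]
    congr 1
    exact List.map_congr_left fun x hx => ih ⟨x, hx⟩
  | _ => simp_all [Tm.ren, forget, UTm.ren]

theorem forget_liftSub (σ : Nat → Tm (EConst S)) :
    forget ∘ Tm.liftSub σ = UTm.liftSub (forget ∘ σ) := by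
  funext n
  cases n with
  | zero => simp [Tm.liftSub, UTm.liftSub, forget]
  | succ n => simp [Tm.liftSub, UTm.liftSub, forget_ren]

theorem forget_sub (σ : Nat → Tm (EConst S)) (t : Tm (EConst S)) :
    forget (Tm.sub σ t) = UTm.sub (forget ∘ σ) (forget t) := by
  induction σ, t using Tm.sub.induct with
  | case2 σ c Ms ih =>
    rw [Tm.sub_const, forget_const, forget_const, UTm.sub_ofConst]
    simp only [List.map_map]
    congr 1
    exact List.map_congr_left fun x hx => ih ⟨x, hx⟩
  | _ => simp_all [Tm.sub, forget, UTm.sub, forget_liftSub]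

theorem forget_substAt_zero (N M : Tm (EConst S)) :
    forget (Tm.substAt 0 N M) = UTm.inst (forget N) (forget M) := by
  rw [Tm.substAt, forget_sub, UTm.inst]
  congr 1
  funext n
  cases n with
  | zero => exact (forget_ren id N).trans (UTm.ren_id _)
  | succ n => simp [UTm.single, forget]

/-- A Dedukti rewrite step is a parallel step on the underlying untyped terms. -/
theorem UPar.of_step {Ar : S → S → Prop} {Rr : S → S → S → Prop} {M N : Tm (EConst S)}
    (h : Step (rulesEPTS Ar Rr) M N) : UPar Rr (forget M) (forget N) := by
  induction h with
  | base h =>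
    rcases h with ⟨A, P, Q, rfl, rfl⟩ | ⟨rl, hrl, σ, rfl, rfl⟩
    · rw [forget_substAt_zero]
      simp only [forget]
      exact .beta (.refl _) (.refl _)
    · rcases hrl with hrl | hrl
      · rcases hrl with ⟨_⟩
        simp only [Ucon, Tm.sub_const, forget_const, List.map_cons, List.map_nil]
        exact .junk
      · rcases hrl with ⟨hR⟩
        simp only [absC, Tm.sub_const, forget_const, List.map_cons, List.map_nil, Tm.sub, forget]
        exact .cbeta hR (.refl _) (.refl _)
  | appL _ ih => simpa only [forget] using UPar.app ih (.refl _)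
  | appR _ ih => simpa only [forget] using UPar.app (.refl _) ih
  | lamA _ _ => simpa only [forget] using UPar.refl _
  | lamM _ ih => simpa only [forget] using UPar.lam ih
  | piA _ _ => simpa only [forget] using UPar.junk
  | piB _ _ => simpa only [forget] using UPar.junk
  | constArg _ ih =>
    simp only [forget_const, List.map_append, List.map_cons]
    exact .ofConst _ (List.rel_append (List.forall₂_same.2 fun _ _ => .refl _)
      (.cons ih (List.forall₂_same.2 fun _ _ => .refl _)))

theorem UPar.eqvGen_of_conv {Ar : S → S → Prop} {Rr : S → S → S → Prop} {M N : Tm (EConst S)}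
    (h : Conv (rulesEPTS Ar Rr) M N) : Relation.EqvGen (UPar Rr) (forget M) (forget N) := by
  induction h with
  | rel _ _ h => exact .rel _ _ (.of_step h)
  | refl _ => exact .refl _
  | symm _ _ _ ih => exact .symm _ _ ih
  | trans _ _ _ _ _ ih₁ ih₂ => exact .trans _ _ _ ih₁ ih₂

/-! ### Embedding EPTS terms -/

/-- The untyped term underlying the translation of an EPTS term. -/
def embed : ETm S → UTm S
  | .var n => .var n
  | .sort s => .u s
  | .pi s₁ s₂ A B => .prod s₁ s₂ (embed A) (.lam (embed B))
  | .lam s₁ s₂ A B M => .abs s₁ s₂ (embed A) (.lam (embed B)) (.lam (embed M))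
  | .app s₁ s₂ A B M N => .capp s₁ s₂ (embed A) (.lam (embed B)) (embed M) (embed N)

theorem forget_trans (M : ETm S) : forget (trans M) = embed M := by
  induction M <;>
    simp_all [trans, embed, ucon, ProdC, absC, appC, forget_const, UTm.ofConst, forget]

theorem embed_injective : Function.Injective (embed : ETm S → UTm S) := by
  intro M
  induction M <;> intro N h <;> cases N <;> simp_all [embed]
  all_goals grind

theorem embed_ren (ρ : Nat → Nat) (M : ETm S) : embed (ETm.ren ρ M) = UTm.ren ρ (embed M) := by
  induction M generalizing ρ <;> simp_all [ETm.ren, embed, UTm.ren]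

theorem embed_liftSub (σ : Nat → ETm S) :
    UTm.liftSub (fun n => embed (σ n)) = fun n => embed (ETm.liftSub σ n) := by
  funext n
  cases n with
  | zero => rfl
  | succ n => simp [ETm.liftSub, UTm.liftSub, embed_ren]

theorem embed_sub (σ : Nat → ETm S) (M : ETm S) :
    embed (ETm.sub σ M) = UTm.sub (fun n => embed (σ n)) (embed M) := by
  induction M generalizing σ <;> simp_all [ETm.sub, embed, UTm.sub, embed_liftSub]

theorem embed_substAt_zero (N M : ETm S) :
    embed (ETm.substAt 0 N M) = UTm.inst (embed N) (embed M) := by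
  rw [ETm.substAt, embed_sub, UTm.inst]
  congr 1
  funext n
  cases n with
  | zero => exact (embed_ren id N).trans (UTm.ren_id _)
  | succ n => simp [UTm.single, embed]

namespace ETm

theorem ren_substAt_zero (ρ : Nat → Nat) (N M : ETm S) :
    ren ρ (substAt 0 N M) = substAt 0 (ren ρ N) (ren (Tm.liftRen ρ) M) :=
  embed_injective (by simp only [embed_ren, embed_substAt_zero, UTm.ren_inst])

theorem sub_substAt_zero (σ : Nat → ETm S) (N M : ETm S) :
    sub σ (substAt 0 N M) = substAt 0 (sub σ N) (sub (liftSub σ) M) :=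
  embed_injective (by
    simp only [embed_sub, embed_substAt_zero, UTm.sub_inst, embed_liftSub])

end ETm

/-! ### Substitution and reduction in the EPTS -/

namespace EStep
variable {Rr : S → S → S → Prop}

theorem ren (ρ : Nat → Nat) {M N : ETm S} (h : EStep Rr M N) :
    EStep Rr (ETm.ren ρ M) (ETm.ren ρ N) := by
  induction h generalizing ρ with
  | base h =>
    obtain ⟨s₁, s₂, s₃, A, B, A', B', P, Q, hR, rfl, rfl⟩ := h
    rw [ETm.ren_substAt_zero]
    exact .base ⟨s₁, s₂, s₃, _, _, _, _, _, _, hR, rfl, rfl⟩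
  | piA _ ih => exact .piA (ih _)
  | piB _ ih => exact .piB (ih _)
  | lamA _ ih => exact .lamA (ih _)
  | lamB _ ih => exact .lamB (ih _)
  | lamM _ ih => exact .lamM (ih _)
  | appA _ ih => exact .appA (ih _)
  | appB _ ih => exact .appB (ih _)
  | appM _ ih => exact .appM (ih _)
  | appN _ ih => exact .appN (ih _)

theorem sub (σ : Nat → ETm S) {M N : ETm S} (h : EStep Rr M N) :
    EStep Rr (ETm.sub σ M) (ETm.sub σ N) := by
  induction h generalizing σ with
  | base h =>
    obtain ⟨s₁, s₂, s₃, A, B, A', B', P, Q, hR, rfl, rfl⟩ := h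
    rw [ETm.sub_substAt_zero]
    exact .base ⟨s₁, s₂, s₃, _, _, _, _, _, _, hR, rfl, rfl⟩
  | piA _ ih => exact .piA (ih _)
  | piB _ ih => exact .piB (ih _)
  | lamA _ ih => exact .lamA (ih _)
  | lamB _ ih => exact .lamB (ih _)
  | lamM _ ih => exact .lamM (ih _)
  | appA _ ih => exact .appA (ih _)
  | appB _ ih => exact .appB (ih _)
  | appM _ ih => exact .appM (ih _)
  | appN _ ih => exact .appN (ih _)

end EStep

/-- Many-step EPTS reduction. -/
abbrev ESteps (Rr : S → S → S → Prop) : ETm S → ETm S → Prop := Relation.ReflTransGen (EStep Rr)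

namespace ESteps
variable {Rr : S → S → S → Prop}

theorem pi {s₁ s₂ : S} {A A' B B' : ETm S} (hA : ESteps Rr A A') (hB : ESteps Rr B B') :
    ESteps Rr (.pi s₁ s₂ A B) (.pi s₁ s₂ A' B') :=
  (hA.lift (ETm.pi s₁ s₂ · B) fun _ _ => .piA).trans
    (hB.lift (ETm.pi s₁ s₂ A' ·) fun _ _ => .piB)

theorem lam {s₁ s₂ : S} {A A' B B' M M' : ETm S} (hA : ESteps Rr A A') (hB : ESteps Rr B B')
    (hM : ESteps Rr M M') : ESteps Rr (.lam s₁ s₂ A B M) (.lam s₁ s₂ A' B' M') :=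
  ((hA.lift (ETm.lam s₁ s₂ · B M) fun _ _ => .lamA).trans
    (hB.lift (ETm.lam s₁ s₂ A' · M) fun _ _ => .lamB)).trans
    (hM.lift (ETm.lam s₁ s₂ A' B' ·) fun _ _ => .lamM)

theorem app {s₁ s₂ : S} {A A' B B' M M' N N' : ETm S} (hA : ESteps Rr A A')
    (hB : ESteps Rr B B') (hM : ESteps Rr M M') (hN : ESteps Rr N N') :
    ESteps Rr (.app s₁ s₂ A B M N) (.app s₁ s₂ A' B' M' N') :=
  (((hA.lift (ETm.app s₁ s₂ · B M N) fun _ _ => .appA).trans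
    (hB.lift (ETm.app s₁ s₂ A' · M N) fun _ _ => .appB)).trans
    (hM.lift (ETm.app s₁ s₂ A' B' · N) fun _ _ => .appM)).trans
    (hN.lift (ETm.app s₁ s₂ A' B' M' ·) fun _ _ => .appN)

theorem liftSub {σ σ' : Nat → ETm S} (h : ∀ n, ESteps Rr (σ n) (σ' n)) (n : Nat) :
    ESteps Rr (ETm.liftSub σ n) (ETm.liftSub σ' n) := by
  cases n with
  | zero => exact .refl
  | succ n => exact (h n).lift _ fun _ _ => EStep.ren _

theorem sub_of_pointwise {σ σ' : Nat → ETm S} (h : ∀ n, ESteps Rr (σ n) (σ' n)) (M : ETm S) :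
    ESteps Rr (ETm.sub σ M) (ETm.sub σ' M) := by
  induction M generalizing σ σ' with
  | var n => exact h n
  | sort s => exact .refl
  | pi _ _ _ _ ihA ihB => exact pi (ihA h) (ihB (liftSub h))
  | lam _ _ _ _ _ ihA ihB ihM => exact lam (ihA h) (ihB (liftSub h)) (ihM (liftSub h))
  | app _ _ _ _ _ _ ihA ihB ihM ihN => exact app (ihA h) (ihB (liftSub h)) (ihM h) (ihN h)

theorem substAt_zero {M M' N N' : ETm S} (hM : ESteps Rr M M') (hN : ESteps Rr N N') :
    ESteps Rr (ETm.substAt 0 N M) (ETm.substAt 0 N' M') := by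
  refine (hM.lift (ETm.substAt 0 N) fun _ _ => EStep.sub _).trans (sub_of_pointwise (fun n => ?_) M')
  cases n with
  | zero => exact hN.lift (ETm.ren id) fun _ _ => EStep.ren id
  | succ n => exact .refl

end ESteps

/-! ### Reading back EPTS terms -/

/-- `ReadBack t M`: the untyped term `t` is an invertible form, and `M` is its inverse
translation, in which framework redexes are contracted. -/
inductive ReadBack : UTm S → ETm S → Prop
  | var {n} : ReadBack (.var n) (.var n)
  | u {s} : ReadBack (.u s) (.sort s)
  | prod {s₁ s₂ tA tB A B} : ReadBack tA A → ReadBack tB B →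
      ReadBack (.prod s₁ s₂ tA (.lam tB)) (.pi s₁ s₂ A B)
  | abs {s₁ s₂ tA tB tM A B M} : ReadBack tA A → ReadBack tB B → ReadBack tM M →
      ReadBack (.abs s₁ s₂ tA (.lam tB) (.lam tM)) (.lam s₁ s₂ A B M)
  | capp {s₁ s₂ tA tB tM tN A B M N} : ReadBack tA A → ReadBack tB B → ReadBack tM M →
      ReadBack tN N → ReadBack (.capp s₁ s₂ tA (.lam tB) tM tN) (.app s₁ s₂ A B M N)
  | beta {tM tN M N} : ReadBack tM M → ReadBack tN N →
      ReadBack (.app (.lam tM) tN) (ETm.substAt 0 N M)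

namespace ReadBack
variable {Rr : S → S → S → Prop}

theorem embed_self (M : ETm S) : ReadBack (embed M) M := by
  induction M <;> constructor <;> assumption

theorem ren (ρ : Nat → Nat) {t : UTm S} {M : ETm S} (h : ReadBack t M) :
    ReadBack (UTm.ren ρ t) (ETm.ren ρ M) := by
  induction h generalizing ρ with
  | beta _ _ ihM ihN =>
    rw [ETm.ren_substAt_zero]
    exact .beta (ihM _) (ihN _)
  | _ => constructor <;> simp_all

theorem liftSub {σ : Nat → UTm S} {τ : Nat → ETm S} (h : ∀ n, ReadBack (σ n) (τ n)) (n : Nat) :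
    ReadBack (UTm.liftSub σ n) (ETm.liftSub τ n) := by
  cases n with
  | zero => exact .var
  | succ n => exact (h n).ren _

theorem sub {σ : Nat → UTm S} {τ : Nat → ETm S} (hσ : ∀ n, ReadBack (σ n) (τ n))
    {t : UTm S} {M : ETm S} (h : ReadBack t M) : ReadBack (UTm.sub σ t) (ETm.sub τ M) := by
  induction h generalizing σ τ with
  | var => exact hσ _
  | u => exact .u
  | prod _ _ ihA ihB => exact .prod (ihA hσ) (ihB (liftSub hσ))
  | abs _ _ _ ihA ihB ihM => exact .abs (ihA hσ) (ihB (liftSub hσ)) (ihM (liftSub hσ))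
  | capp _ _ _ _ ihA ihB ihM ihN =>
    exact .capp (ihA hσ) (ihB (liftSub hσ)) (ihM hσ) (ihN hσ)
  | beta _ _ ihM ihN =>
    rw [ETm.sub_substAt_zero]
    exact .beta (ihM (liftSub hσ)) (ihN hσ)

theorem inst {tM tN : UTm S} {M N : ETm S} (hM : ReadBack tM M) (hN : ReadBack tN N) :
    ReadBack (UTm.inst tN tM) (ETm.substAt 0 N M) := by
  refine hM.sub fun n => ?_
  cases n with
  | zero =>
    have h := hN.ren id
    rw [UTm.ren_id] at h
    exact h
  | succ n => exact .var

/-- A parallel step from an invertible form is simulated by EPTS reduction. -/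
theorem simulation {t t' : UTm S} {M : ETm S} (h : ReadBack t M) (ht : UPar Rr t t') :
    ∃ M', ESteps Rr M M' ∧ ReadBack t' M' := by
  induction h generalizing t' with
  | var => cases ht; exact ⟨_, .refl, .var⟩
  | u => cases ht; exact ⟨_, .refl, .u⟩
  | prod _ _ ihA ihB =>
    cases ht with
    | prod hA hB =>
      cases hB with
      | lam hB =>
        obtain ⟨_, eA, rA⟩ := ihA hA
        obtain ⟨_, eB, rB⟩ := ihB hB
        exact ⟨_, .pi eA eB, .prod rA rB⟩
  | abs _ _ _ ihA ihB ihM =>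
    cases ht with
    | abs hA hB hM =>
      cases hB with
      | lam hB =>
        cases hM with
        | lam hM =>
          obtain ⟨_, eA, rA⟩ := ihA hA
          obtain ⟨_, eB, rB⟩ := ihB hB
          obtain ⟨_, eM, rM⟩ := ihM hM
          exact ⟨_, .lam eA eB eM, .abs rA rB rM⟩
  | capp _ _ _ _ ihA ihB ihM ihN =>
    cases ht with
    | capp hA hB hM hN =>
      cases hB with
      | lam hB =>
        obtain ⟨_, eA, rA⟩ := ihA hA
        obtain ⟨_, eB, rB⟩ := ihB hB
        obtain ⟨_, eM, rM⟩ := ihM hM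
        obtain ⟨_, eN, rN⟩ := ihN hN
        exact ⟨_, .app eA eB eM eN, .capp rA rB rM rN⟩
    | cbeta hR hP hN =>
      obtain ⟨_, eM, rM⟩ := ihM (.abs (.refl _) (.refl _) hP)
      obtain ⟨_, eN, rN⟩ := ihN hN
      cases rM with
      | abs _ _ rP =>
        exact ⟨_, (ESteps.app .refl .refl eM eN).tail
          (.base ⟨_, _, _, _, _, _, _, _, _, hR, rfl, rfl⟩), .beta rP rN⟩
  | beta _ _ ihM ihN =>
    cases ht with
    | app hM hN =>
      cases hM with
      | lam hM =>
        obtain ⟨_, eM, rM⟩ := ihM hM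
        obtain ⟨_, eN, rN⟩ := ihN hN
        exact ⟨_, eM.substAt_zero eN, .beta rM rN⟩
    | beta hM hN =>
      obtain ⟨_, eM, rM⟩ := ihM hM
      obtain ⟨_, eN, rN⟩ := ihN hN
      exact ⟨_, eM.substAt_zero eN, rM.inst rN⟩

theorem simulation_reflTransGen {t t' : UTm S} {M : ETm S} (h : ReadBack t M)
    (ht : Relation.ReflTransGen (UPar Rr) t t') : ∃ M', ESteps Rr M M' ∧ ReadBack t' M' := by
  induction ht with
  | refl => exact ⟨M, .refl, h⟩
  | tail _ hstep ih =>
    obtain ⟨M₁, e₁, r₁⟩ := ih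
    obtain ⟨M₂, e₂, r₂⟩ := r₁.simulation hstep
    exact ⟨M₂, e₁.trans e₂, r₂⟩

theorem functional {t : UTm S} {M N : ETm S} (hM : ReadBack t M) (hN : ReadBack t N) :
    M = N := by
  induction hM generalizing N <;> cases hN <;> grind

end ReadBack

theorem ESteps.eConv {Rr : S → S → S → Prop} {M N : ETm S} (h : ESteps Rr M N) :
    EConv Rr M N := by
  induction h with
  | refl => exact .refl _
  | tail _ hstep ih => exact .trans _ _ _ ih (.rel _ _ hstep)

/-- Reflection of computation. -/
theorem reflection_of_computation {S : Type} (Ar : S → S → Prop) (Rr : S → S → S → Prop)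
    (hfun : FunctionalSpec Ar Rr) :
    (∀ M N : ETm S, Relation.ReflTransGen (Step (rulesEPTS Ar Rr)) (trans M) (trans N) →
      Relation.ReflTransGen (EStep Rr) M N) ∧
    (∀ M N : ETm S, Conv (rulesEPTS Ar Rr) (trans M) (trans N) → EConv Rr M N) := by
  constructor
  · intro M N h
    have h' : Relation.ReflTransGen (UPar Rr) (forget (trans M)) (forget (trans N)) :=
      h.lift forget fun _ _ => UPar.of_step
    simp only [forget_trans] at h'
    obtain ⟨N', e, r⟩ := (ReadBack.embed_self M).simulation_reflTransGen h'
    exact r.functional (ReadBack.embed_self N) ▸ e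
  · intro M N h
    have h' := UPar.eqvGen_of_conv h
    simp only [forget_trans] at h'
    obtain ⟨d, hM, hN⟩ := UPar.join_of_eqvGen h'
    obtain ⟨M', eM, rM⟩ := (ReadBack.embed_self M).simulation_reflTransGen hM
    obtain ⟨N', eN, rN⟩ := (ReadBack.embed_self N).simulation_reflTransGen hN
    obtain rfl := rM.functional rN
    exact .trans _ _ _ eM.eConv (.symm _ _ eN.eConv)

end DKPaper
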